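/- arXiv:1601.03436 — 2 statements merged into one kernel-verified Lean document; each statement's English description precedes it below -/
import Mathlib

section
/- Let R be an associative unital ring, M a left R-module that is projective in σ[M], and N a semiprime submodule of M. If J is a fully invariant submodule of M with J^n ≤ N for some n ≥ 1, then J ≤ N. -/
universe u v

section Defs

variable (R : Type u) [Ring R] (M : Type v) [AddCommGroup M] [Module R M]

/-- The product `K ·_M L` of submodules: the sum of all images `f K` over `f : M → L`. -/
def prodM (K L : Submodule R M) : Submodule R M :=
  ⨆ (f : M →ₗ[R] M) (_ : LinearMap.range f ≤ L), K.map f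

/-- A submodule is fully invariant if it is stable under every endomorphism. -/
def IsFullyInvariant (N : Submodule R M) : Prop :=
  ∀ f : M →ₗ[R] M, N.map f ≤ N

/-- A fully invariant submodule `N` is prime in `M` if `K ·_M L ≤ N` implies `K ≤ N` or
`L ≤ N` for all fully invariant submodules `K, L`. -/
def IsPrimeSubmodule (N : Submodule R M) : Prop :=
  IsFullyInvariant R M N ∧
    ∀ K L : Submodule R M, IsFullyInvariant R M K → IsFullyInvariant R M L →
      prodM R M K L ≤ N → K ≤ N ∨ L ≤ N

/-- A fully invariant submodule `N` is semiprime in `M` if `K ·_M K ≤ N` implies `K ≤ N`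
for every fully invariant submodule `K`. -/
def IsSemiprimeSubmodule (N : Submodule R M) : Prop :=
  IsFullyInvariant R M N ∧
    ∀ K : Submodule R M, IsFullyInvariant R M K → prodM R M K K ≤ N → K ≤ N

/-- `M` is a semiprime module if `⊥` is semiprime in `M`. -/
def IsSemiprimeModule : Prop := IsSemiprimeSubmodule R M ⊥

/-- `M` is a prime module if `⊥` is prime in `M`. -/
def IsPrimeModule : Prop := IsPrimeSubmodule R M ⊥

/-- A minimal prime submodule: prime and minimal among prime submodules. -/
def IsMinimalPrimeSubmodule (P : Submodule R M) : Prop :=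
  IsPrimeSubmodule R M P ∧ ∀ Q : Submodule R M, IsPrimeSubmodule R M Q → Q ≤ P → Q = P

/-- `X` is `M`-generated: a homomorphic image of a direct sum of copies of `M`. -/
def IsMGenerated (X : Type v) [AddCommGroup X] [Module R X] : Prop :=
  ∃ (ι : Type v) (f : (ι →₀ M) →ₗ[R] X), Function.Surjective f

/-- `X` belongs to `σ[M]`: isomorphic to a submodule of an `M`-generated module. -/
def InSigmaM (X : Type v) [AddCommGroup X] [Module R X] : Prop :=
  ∃ (Y : Type v) (_ : AddCommGroup Y) (_ : Module R Y),
    IsMGenerated R M Y ∧ ∃ g : X →ₗ[R] Y, Function.Injective g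

/-- `M` is projective in `σ[M]`. -/
def ProjectiveInSigmaM : Prop :=
  ∀ (A B : Type v) [AddCommGroup A] [Module R A] [AddCommGroup B] [Module R B],
    InSigmaM R M A → InSigmaM R M B →
      ∀ g : A →ₗ[R] B, Function.Surjective g →
        ∀ h : M →ₗ[R] B, ∃ f : M →ₗ[R] A, g ∘ₗ f = h

/-- `N` is essential in `M`. -/
def IsEssentialSub (N : Submodule R M) : Prop :=
  ∀ L : Submodule R M, L ≠ ⊥ → N ⊓ L ≠ ⊥

/-- `M` has finite uniform dimension: no infinite independent family of nonzero submodules. -/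
def HasFinUdim : Prop :=
  ¬ ∃ f : ℕ → Submodule R M, (∀ n, f n ≠ ⊥) ∧
      ∀ n, Disjoint (f n) (⨆ (m) (_ : m ≠ n), f m)

/-- A left annihilator in `M`: an intersection `⋂_{f ∈ X} ker f` with `X ⊆ End_R(M)`. -/
def IsLeftAnnihilatorSub (N : Submodule R M) : Prop :=
  ∃ X : Set (M →ₗ[R] M), N = ⨅ f ∈ X, LinearMap.ker f

/-- ACC on left annihilators. -/
def AccLeftAnnihilators : Prop :=
  ∀ a : ℕ → Submodule R M, (∀ n, IsLeftAnnihilatorSub R M (a n)) → Monotone a →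
    ∃ n, ∀ m, n ≤ m → a m = a n

/-- `M` is a Goldie module: ACC on left annihilators and finite uniform dimension. -/
def IsGoldieModule : Prop := AccLeftAnnihilators R M ∧ HasFinUdim R M

/-- `Ann_M(K) = ⋂ { ker f | f ∈ Hom_R(M, K) }`. -/
def annM (K : Submodule R M) : Submodule R M :=
  ⨅ (f : M →ₗ[R] M) (_ : LinearMap.range f ≤ K), LinearMap.ker f

/-- `N` is an annihilator submodule: `N = Ann_M(K)` for some nonzero submodule `K`. -/
def IsAnnihilatorSub (N : Submodule R M) : Prop :=
  ∃ K : Submodule R M, K ≠ ⊥ ∧ N = annM R M K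

/-- A submodule `U` is uniform: nonzero and every nonzero submodule of `U` is essential in `U`. -/
def IsUniformSub (U : Submodule R M) : Prop :=
  U ≠ ⊥ ∧ ∀ A B : Submodule R M, A ≤ U → B ≤ U → A ≠ ⊥ → B ≠ ⊥ → A ⊓ B ≠ ⊥

/-- A submodule `U` is monoform: nonzero and every nonzero homomorphism `L → U` from a
submodule `L ≤ U` is injective. -/
def IsMonoformSub (U : Submodule R M) : Prop :=
  U ≠ ⊥ ∧ ∀ L : Submodule R M, L ≤ U → ∀ f : L →ₗ[R] U, f ≠ 0 → Function.Injective f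

/-- `M` has enough monoforms: every nonzero submodule contains a monoform submodule. -/
def HasEnoughMonoforms : Prop :=
  ∀ N : Submodule R M, N ≠ ⊥ → ∃ U : Submodule R M, U ≤ N ∧ IsMonoformSub R M U

/-- `M` is weakly compressible. -/
def WeaklyCompressible : Prop :=
  ∀ N : Submodule R M, N ≠ ⊥ → ∃ f : M →ₗ[R] M, LinearMap.range f ≤ N ∧ f ∘ₗ f ≠ 0

/-- `M` is retractable: `Hom_R(M, N) ≠ 0` for every nonzero submodule `N`. -/
def Retractable : Prop :=
  ∀ N : Submodule R M, N ≠ ⊥ → ∃ f : M →ₗ[R] M, LinearMap.range f ≤ N ∧ f ≠ 0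

/-- Powers of a fully invariant submodule: `J^0 = ⊥`, `J^1 = J`, `J^(m+1) = J ·_M J^m`. -/
def fipow (J : Submodule R M) : ℕ → Submodule R M
  | 0 => ⊥
  | 1 => J
  | n + 2 => prodM R M J (fipow J (n + 1))

end Defs

section RingDefs

variable (S : Type*) [Ring S]

/-- A ring is semiprime: no nonzero two-sided ideal squares to zero. -/
def IsSemiprimeRing : Prop :=
  ∀ I : TwoSidedIdeal S, (∀ a ∈ I, ∀ b ∈ I, a * b = 0) → I = ⊥

/-- A ring is prime: `I · J = 0` forces `I = 0` or `J = 0` for two-sided ideals. -/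
def IsPrimeRing : Prop :=
  ∀ I J : TwoSidedIdeal S, (∀ a ∈ I, ∀ b ∈ J, a * b = 0) → I = ⊥ ∨ J = ⊥

/-- A right annihilator subset of `S`: `{ s | X s = 0 }` for some `X ⊆ S`. -/
def IsRightAnnihilatorSet (T : Set S) : Prop :=
  ∃ X : Set S, T = {s : S | ∀ x ∈ X, x * s = 0}

/-- ACC on right annihilators of the ring `S`. -/
def AccRightAnnihilators : Prop :=
  ∀ a : ℕ → Set S, (∀ n, IsRightAnnihilatorSet S (a n)) → (∀ n, a n ⊆ a (n + 1)) →
    ∃ n, ∀ m, n ≤ m → a m = a n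

/-- `S` is a right Goldie ring: ACC on right annihilators and finite uniform dimension
as a right `S`-module. -/
def IsRightGoldieRing : Prop :=
  AccRightAnnihilators S ∧ HasFinUdim Sᵐᵒᵖ S

end RingDefs

section

variable {R : Type u} [Ring R] {M : Type v} [AddCommGroup M] [Module R M]

theorem prodM_le_iff {K L P : Submodule R M} :
    prodM R M K L ≤ P ↔ ∀ f : M →ₗ[R] M, LinearMap.range f ≤ L → K.map f ≤ P :=
  iSup₂_le_iff

theorem map_le_prodM {K L : Submodule R M} {f : M →ₗ[R] M} (hf : LinearMap.range f ≤ L) :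
    K.map f ≤ prodM R M K L :=
  prodM_le_iff.1 le_rfl f hf

theorem prodM_le_right (K L : Submodule R M) : prodM R M K L ≤ L :=
  prodM_le_iff.2 fun _ hf => LinearMap.map_le_range.trans hf

theorem prodM_mono_right {K L L' : Submodule R M} (h : L ≤ L') :
    prodM R M K L ≤ prodM R M K L' :=
  prodM_le_iff.2 fun _ hf => map_le_prodM (hf.trans h)

theorem isFullyInvariant_prodM {K L : Submodule R M} (hL : IsFullyInvariant R M L) :
    IsFullyInvariant R M (prodM R M K L) := by
  intro g
  rw [Submodule.map_le_iff_le_comap, prodM_le_iff]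
  intro f hf
  rw [← Submodule.map_le_iff_le_comap, ← Submodule.map_comp]
  apply map_le_prodM
  rw [LinearMap.range_comp]
  exact (Submodule.map_mono hf).trans (hL g)

/-- One half of associativity of the product; it does not need projectivity. -/
theorem prodM_assoc_le (K L P : Submodule R M) :
    prodM R M (prodM R M K L) P ≤ prodM R M K (prodM R M L P) := by
  refine prodM_le_iff.2 fun g hg => ?_
  rw [Submodule.map_le_iff_le_comap, prodM_le_iff]
  intro f hf
  rw [← Submodule.map_le_iff_le_comap, ← Submodule.map_comp]
  apply map_le_prodM
  rw [LinearMap.range_comp]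
  exact (Submodule.map_mono hf).trans (map_le_prodM hg)

theorem isFullyInvariant_fipow {J : Submodule R M} (hJ : IsFullyInvariant R M J) (n : ℕ) :
    IsFullyInvariant R M (fipow R M J (n + 1)) := by
  induction n with
  | zero => exact hJ
  | succ n ih => exact isFullyInvariant_prodM ih

theorem prodM_fipow_le (J : Submodule R M) (a b : ℕ) :
    prodM R M (fipow R M J (a + 1)) (fipow R M J (b + 1)) ≤ fipow R M J (b + 2) := by
  cases a with
  | zero => exact le_rfl
  | succ a => exact (prodM_assoc_le _ _ _).trans (prodM_mono_right (prodM_le_right _ _))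

theorem IsSemiprimeSubmodule.le_of_fipow_le {N J : Submodule R M}
    (hN : IsSemiprimeSubmodule R M N) (hJ : IsFullyInvariant R M J) (n : ℕ)
    (h : fipow R M J (n + 1) ≤ N) : J ≤ N := by
  induction n with
  | zero => exact h
  | succ n ih => exact ih (hN.2 _ (isFullyInvariant_fipow hJ n) ((prodM_fipow_le J n n).trans h))

end

/-- For `M` projective in `σ[M]`, `N` semiprime in `M`, and `J` fully
invariant with `J^n ≤ N` for some `n ≥ 1`, we have `J ≤ N`. -/
theorem stmt17 (R : Type u) [Ring R] (M : Type v) [AddCommGroup M] [Module R M]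
    (hproj : ProjectiveInSigmaM R M) (N : Submodule R M)
    (hN : IsSemiprimeSubmodule R M N) (J : Submodule R M)
    (hJ : IsFullyInvariant R M J) (n : ℕ) (hn : 1 ≤ n)
    (hpow : fipow R M J n ≤ N) :
    J ≤ N := by
  obtain ⟨m, rfl⟩ := Nat.exists_eq_add_of_le' hn
  exact hN.le_of_fipow_le hJ m hpow
end

section
/- Let R be an associative unital ring and M a left R-module that is projective in σ[M]. If M is semiprime, then M is retractable. -/
universe u v

/-- The map `⨁_f N → M` indexed by the endomorphisms `f` of `M`, acting by `f` on the
summand with index `f`. -/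
noncomputable def sumEndomorphisms {R : Type u} [Ring R] {M : Type v} [AddCommGroup M]
    [Module R M] (N : Submodule R M) : ((M →ₗ[R] M) →₀ N) →ₗ[R] M :=
  Finsupp.lsum ℕ fun f => f ∘ₗ N.subtype

theorem isFullyInvariant_range_sumEndomorphisms {R : Type u} [Ring R] {M : Type v}
    [AddCommGroup M] [Module R M] (N : Submodule R M) :
    IsFullyInvariant R M (LinearMap.range (sumEndomorphisms N)) := by
  rintro g _ ⟨_, ⟨x, rfl⟩, rfl⟩
  have h : g ∘ₗ sumEndomorphisms N =
      sumEndomorphisms N ∘ₗ Finsupp.lmapDomain N R fun f => g ∘ₗ f := by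
    ext f n
    simp [sumEndomorphisms]
  exact ⟨_, (LinearMap.congr_fun h x).symm⟩

theorem le_range_sumEndomorphisms {R : Type u} [Ring R] {M : Type v} [AddCommGroup M]
    [Module R M] (N : Submodule R M) : N ≤ LinearMap.range (sumEndomorphisms N) :=
  fun n hn => ⟨Finsupp.single LinearMap.id ⟨n, hn⟩, by simp [sumEndomorphisms]⟩

theorem inSigmaM_submodule {R : Type u} [Ring R] {M : Type v} [AddCommGroup M] [Module R M]
    (K : Submodule R M) : InSigmaM R M K :=
  ⟨M, inferInstance, inferInstance,
    ⟨PUnit, Finsupp.lapply PUnit.unit, fun m => ⟨Finsupp.single PUnit.unit m, by simp⟩⟩,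
    K.subtype, K.injective_subtype⟩

theorem inSigmaM_finsupp_submodule {R : Type u} [Ring R] {M : Type v} [AddCommGroup M]
    [Module R M] (ι : Type v) (N : Submodule R M) : InSigmaM R M (ι →₀ N) :=
  ⟨ι →₀ M, inferInstance, inferInstance, ⟨ι, LinearMap.id, Function.surjective_id⟩,
    Finsupp.mapRange.linearMap N.subtype,
    Finsupp.mapRange_injective _ (map_zero _) N.injective_subtype⟩

/-- If `M` is projective in `σ[M]` and `Hom(M, N) = 0`, then every homomorphism from `M` to
the fully invariant submodule generated by `N` vanishes. -/
theorem eq_zero_of_range_le_range_sumEndomorphisms {R : Type u} [Ring R] {M : Type v}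
    [AddCommGroup M] [Module R M] (hproj : ProjectiveInSigmaM R M) {N : Submodule R M}
    (hN : ∀ f : M →ₗ[R] M, LinearMap.range f ≤ N → f = 0) {h : M →ₗ[R] M}
    (hh : LinearMap.range h ≤ LinearMap.range (sumEndomorphisms N)) : h = 0 := by
  obtain ⟨l, hl⟩ := hproj _ _ (inSigmaM_finsupp_submodule (M →ₗ[R] M) N)
    (inSigmaM_submodule _) (sumEndomorphisms N).rangeRestrict
    (LinearMap.surjective_rangeRestrict _)
    (h.codRestrict _ fun m => hh ⟨m, rfl⟩)
  have hl0 : l = 0 := by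
    ext m f
    have := hN (N.subtype ∘ₗ Finsupp.lapply f ∘ₗ l) (by rintro _ ⟨m, rfl⟩; simp)
    simpa using LinearMap.congr_fun this m
  ext m
  simpa [hl0] using (congrArg Subtype.val (LinearMap.congr_fun hl m)).symm

/-- If `M` is projective in `σ[M]` and semiprime, then `M` is
retractable. -/
theorem stmt18 (R : Type u) [Ring R] (M : Type v) [AddCommGroup M] [Module R M]
    (hproj : ProjectiveInSigmaM R M) (hsemi : IsSemiprimeModule R M) :
    Retractable R M := by
  intro N hN
  by_contra! hzero
  refine hN (eq_bot_iff.mpr ((le_range_sumEndomorphisms N).trans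
    (hsemi.2 _ (isFullyInvariant_range_sumEndomorphisms N) ?_)))
  refine iSup₂_le fun f hf => ?_
  rw [eq_zero_of_range_le_range_sumEndomorphisms hproj hzero hf, Submodule.map_zero]
end
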